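/- Let δ > 0, d ≥ 2, let n_1,…,n_d be positive integers with geometric mean N = (∏ n_j)^{1/d} and sum S = ∑ n_j, let 0 < p < 1, and set M = c_d N p^{1/d}, where c_d is the Bollobás–Winkler constant. Then there is a constant C = C(δ) sufficiently large such that: (i) if N p^{1/d} ≥ C and 12 S^{2d−2} p^{2−1/d} ≤ d^{d−1} δ c_d, then every median of L(G(K_{n_1,…,n_d},p)) is at most (1+δ)M; (ii) if N p^{1/d} ≥ C and 12 S^{d−1} p ≤ δ, then every median of L(G(K_{n_1,…,n_d},p)) is at least (1−δ)M. -/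

import Mathlib

open Finset MeasureTheory
open scoped Classical BigOperators

/-- An edge of the complete `d`-partite hyper-graph with color classes `[n 0], …, [n (d-1)]`. -/
abbrev Edge {d : ℕ} (n : Fin d → ℕ) := ∀ i : Fin d, Fin (n i)

/-- A `d`-partite hyper-graph, identified with its edge set. -/
abbrev HG {d : ℕ} (n : Fin d → ℕ) := Finset (Edge n)

/-- A finite set of edges is a non-crossing hyper-matching iff any two distinct edges of it
are strictly comparable in every coordinate (equivalently: pairwise node-disjoint and
totally ordered by the componentwise partial order). -/
def NonCrossing {d : ℕ} {n : Fin d → ℕ} (M : Finset (Edge n)) : Prop :=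
  ∀ e ∈ M, ∀ f ∈ M, e ≠ f → (∀ i, e i < f i) ∨ (∀ i, f i < e i)

/-- `L G` is the maximum size of a non-crossing hyper-matching contained in `G`. -/
noncomputable def L {d : ℕ} {n : Fin d → ℕ} (G : HG n) : ℕ :=
  (G.powerset.filter NonCrossing).sup Finset.card

/-- Expectation of `f` under the weight function `w` on a finite outcome type. -/
noncomputable def wExp {α : Type*} [Fintype α] (w : α → ℝ) (f : α → ℝ) : ℝ :=
  ∑ a, w a * f a

/-- Probability of the event `A` under the weight function `w`. -/
noncomputable def wProb {α : Type*} [Fintype α] (w : α → ℝ) (A : Set α) : ℝ :=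
  ∑ a ∈ Finset.univ.filter (· ∈ A), w a

/-- `m` is a median of the random variable `X` under the weights `w`. -/
def IsMedianW {α : Type*} [Fintype α] (w : α → ℝ) (X : α → ℝ) (m : ℝ) : Prop :=
  1 / 2 ≤ wProb w {a | X a ≤ m} ∧ 1 / 2 ≤ wProb w {a | m ≤ X a}

/-- The probability of the outcome `H` in the binomial model in which every element of `α`
is present independently with probability `p`. -/
noncomputable def binomW {α : Type*} [Fintype α] (p : ℝ) (H : Finset α) : ℝ :=
  ∏ a : α, if a ∈ H then p else 1 - p

/-- Weights of the uniform distribution on a finite type. -/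
noncomputable def unifW (α : Type*) [Fintype α] : α → ℝ := fun _ => (Fintype.card α : ℝ)⁻¹

/-- Geometric mean of the class sizes. -/
noncomputable def geoMean {d : ℕ} (n : Fin d → ℕ) : ℝ :=
  (∏ i, (n i : ℝ)) ^ (1 / (d : ℝ))

/-- Sum of the class sizes. -/
def sumSizes {d : ℕ} (n : Fin d → ℕ) : ℝ := ∑ i, (n i : ℝ)

/-- The outcome space of the random `d`-word model: an assignment of one of `k` letters
to every vertex. -/
abbrev WordOmega {d : ℕ} (n : Fin d → ℕ) (k : ℕ) := (Σ i : Fin d, Fin (n i)) → Fin k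

/-- The hyper-graph associated with a letter assignment: an edge is present iff all of its
vertices receive the same letter. -/
noncomputable def wordGraph {d : ℕ} {n : Fin d → ℕ} {k : ℕ} (ω : WordOmega n k) : HG n :=
  Finset.univ.filter (fun e : Edge n => ∀ i j : Fin d, ω ⟨i, e i⟩ = ω ⟨j, e j⟩)

/-- The set of edges of `H` sharing no vertex with any other edge of `H`. -/
noncomputable def isolated {d : ℕ} {n : Fin d → ℕ} (H : HG n) : HG n :=
  H.filter (fun e => ∀ f ∈ H, f ≠ e → ∀ i, e i ≠ f i)

/-- Length of a longest chain among the points `x 0, …, x (m-1)` of `ℝ^d` under the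
componentwise strict order. -/
noncomputable def cubeChain (d m : ℕ) (x : Fin m → Fin d → ℝ) : ℕ :=
  ((Finset.univ : Finset (Finset (Fin m))).filter
    (fun S => ∀ a ∈ S, ∀ b ∈ S, a ≠ b →
      (∀ i, x a i < x b i) ∨ (∀ i, x b i < x a i))).sup Finset.card

/-- The unit cube `[0,1]^d`, to the `m`-th power. -/
def unitCube (d m : ℕ) : Set (Fin m → Fin d → ℝ) := {x | ∀ a i, x a i ∈ Set.Icc (0 : ℝ) 1}

/-- `c` is the Bollobás–Winkler constant in dimension `d`:
`E[H_d(m)] / m^(1/d) → c` as `m → ∞`, where `H_d(m)` is the length of a longest chain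
among `m` independent uniform random points in the unit cube `[0,1]^d`. -/
def IsBWConstant (d : ℕ) (c : ℝ) : Prop :=
  Filter.Tendsto
    (fun m : ℕ => (∫ x in unitCube d m, (cubeChain d m x : ℝ)) / (m : ℝ) ^ (1 / (d : ℝ)))
    Filter.atTop (nhds c)

/-- Expectation of `f` over a random subset of `s` which contains every element of `s`
independently with probability `p`. -/
noncomputable def subsetExp {α : Type*} (p : ℝ) (s : Finset α) (f : Finset α → ℝ) : ℝ :=
  ∑ H ∈ s.powerset, (∏ a ∈ s, if a ∈ H then p else 1 - p) * f H

lemma subsetExp_insert {α : Type*} [DecidableEq α] (p : ℝ) {s : Finset α} {e : α} (he : e ∉ s)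
    (f : Finset α → ℝ) :
    subsetExp p (insert e s) f =
      p * subsetExp p s (fun H => f (insert e H)) + (1 - p) * subsetExp p s f := by
  unfold subsetExp
  rw [Finset.sum_powerset_insert he, add_comm, Finset.mul_sum, Finset.mul_sum]
  congr 1 <;> refine Finset.sum_congr rfl fun H hH => ?_
  · rw [Finset.prod_insert he, if_pos (Finset.mem_insert_self e H), mul_assoc]
    congr 2
    refine Finset.prod_congr rfl fun a ha => ?_
    have : a ≠ e := fun h => he (h ▸ ha)
    simp [this]
  · have : e ∉ H := fun h => he (Finset.mem_powerset.1 hH h)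
    rw [Finset.prod_insert he, if_neg this, mul_assoc]

lemma subsetExp_mono {α : Type*} {p : ℝ} (hp : 0 ≤ p) (hp' : p ≤ 1) {s : Finset α}
    {f g : Finset α → ℝ} (h : ∀ H ⊆ s, f H ≤ g H) : subsetExp p s f ≤ subsetExp p s g := by
  refine Finset.sum_le_sum fun H hH => mul_le_mul_of_nonneg_left (h H (Finset.mem_powerset.1 hH)) ?_
  refine Finset.prod_nonneg fun a _ => ?_
  split_ifs <;> linarith

lemma subsetExp_add {α : Type*} (p : ℝ) (s : Finset α) (f g : Finset α → ℝ) :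
    subsetExp p s (fun H => f H + g H) = subsetExp p s f + subsetExp p s g := by
  simp [subsetExp, mul_add, Finset.sum_add_distrib]

lemma subsetExp_const_mul {α : Type*} (p c : ℝ) (s : Finset α) (f : Finset α → ℝ) :
    subsetExp p s (fun H => c * f H) = c * subsetExp p s f := by
  simp only [subsetExp, Finset.mul_sum]
  exact Finset.sum_congr rfl fun H _ => by ring

lemma subsetExp_one {α : Type*} (p : ℝ) (s : Finset α) : subsetExp p s (fun _ => 1) = 1 := by
  induction s using Finset.induction_on with
  | empty => simp [subsetExp]
  | insert e s he ih => rw [subsetExp_insert p he, ih]; ring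

lemma subsetExp_sq_le {α : Type*} {p : ℝ} (hp : 0 ≤ p) (hp' : p ≤ 1) (s : Finset α)
    (f : Finset α → ℝ) : subsetExp p s f ^ 2 ≤ subsetExp p s (fun H => f H ^ 2) := by
  set μ := subsetExp p s f with hμ
  have h := subsetExp_mono hp hp' (s := s) (f := fun _ => 0) (g := fun H => (f H - μ) ^ 2)
    fun H _ => sq_nonneg _
  have e : subsetExp p s (fun H => (f H - μ) ^ 2) =
      subsetExp p s (fun H => f H ^ 2) - μ ^ 2 := by
    have : (fun H => (f H - μ) ^ 2) = fun H => (f H ^ 2 + (-2 * μ) * f H) + μ ^ 2 * 1 := by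
      funext H; ring
    rw [this, subsetExp_add, subsetExp_add, subsetExp_const_mul, subsetExp_const_mul,
      subsetExp_one, ← hμ]
    ring
  have z : subsetExp p s (fun _ => 0) = 0 := by simp [subsetExp]
  rw [z, e] at h
  linarith

/-- The Efron–Stein inequality for functions of independent Bernoulli variables. -/
lemma subsetExp_efronStein {α : Type*} [DecidableEq α] {p : ℝ} (hp : 0 ≤ p) (hp' : p ≤ 1) (s : Finset α)
    (f : Finset α → ℝ) :
    subsetExp p s (fun H => f H ^ 2) - subsetExp p s f ^ 2 ≤
      (1 - p) * subsetExp p s (fun H => ∑ x ∈ H, (f H - f (H.erase x)) ^ 2) := by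
  induction s using Finset.induction_on generalizing f with
  | empty => simp [subsetExp]
  | insert e s he ih =>
    have h0 := ih f
    have h1 := ih (fun H => f (insert e H))
    have h2 := subsetExp_sq_le hp hp' s (fun H => f (insert e H) + (-1) * f H)
    rw [subsetExp_add, subsetExp_const_mul] at h2
    have hE : subsetExp p s (fun H => ∑ x ∈ insert e H,
        (f (insert e H) - f ((insert e H).erase x)) ^ 2) =
        subsetExp p s (fun H => (f (insert e H) + (-1) * f H) ^ 2) +
        subsetExp p s (fun H => ∑ x ∈ H, (f (insert e H) - f (insert e (H.erase x))) ^ 2) := by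
      rw [← subsetExp_add]
      refine Finset.sum_congr rfl fun H hH => ?_
      have heH : e ∉ H := fun h => he (Finset.mem_powerset.1 hH h)
      congr 1
      beta_reduce
      rw [Finset.sum_insert heH, Finset.erase_insert heH]
      congr 1
      · ring
      · refine Finset.sum_congr rfl fun x hx => ?_
        rw [Finset.erase_insert_of_ne (by rintro rfl; exact heH hx)]
    rw [subsetExp_insert p he, subsetExp_insert p he, subsetExp_insert p he, hE]
    nlinarith [mul_le_mul_of_nonneg_left h1 hp, mul_le_mul_of_nonneg_left h0 (sub_nonneg.2 hp'),
      mul_le_mul_of_nonneg_left h2 (mul_nonneg hp (sub_nonneg.2 hp'))]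

lemma wExp_binomW {α : Type*} [Fintype α] (p : ℝ) (f : Finset α → ℝ) :
    wExp (binomW p) f = subsetExp p Finset.univ f := by
  simp [wExp, subsetExp, binomW]

section Length

variable {d : ℕ} {n : Fin d → ℕ}

lemma card_le_L {G M : HG n} (hM : M ⊆ G) (h : NonCrossing M) : M.card ≤ L G :=
  Finset.le_sup (f := Finset.card) (by simp [hM, h])

lemma exists_card_eq_L (G : HG n) : ∃ M ⊆ G, NonCrossing M ∧ M.card = L G := by
  have hne : (G.powerset.filter NonCrossing).Nonempty := ⟨∅, by simp [NonCrossing]⟩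
  obtain ⟨M, hM, h⟩ := Finset.exists_mem_eq_sup _ hne Finset.card
  simp only [Finset.mem_filter, Finset.mem_powerset] at hM
  exact ⟨M, hM.1, hM.2, h.symm⟩

lemma sum_sq_L_sub_erase_le (G : HG n) :
    ∑ x ∈ G, ((L G : ℝ) - L (G.erase x)) ^ 2 ≤ L G := by
  obtain ⟨M, hMG, hM, hc⟩ := exists_card_eq_L G
  have mono : ∀ x, L (G.erase x) ≤ L G := fun x => by
    obtain ⟨M', h1, h2, h3⟩ := exists_card_eq_L (G.erase x)
    exact h3 ▸ card_le_L (h1.trans (Finset.erase_subset _ _)) h2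
  have key : ∀ x ∈ G, ((L G : ℝ) - L (G.erase x)) ^ 2 ≤ if x ∈ M then 1 else 0 := by
    intro x _
    have hm : (L (G.erase x) : ℝ) ≤ L G := by exact_mod_cast mono x
    split_ifs with hx
    · have : M.card - 1 ≤ L (G.erase x) := by
        rw [← Finset.card_erase_of_mem hx]
        exact card_le_L (Finset.erase_subset_erase _ hMG)
          fun e he f hf => hM e (Finset.mem_of_mem_erase he) f (Finset.mem_of_mem_erase hf)
      have : (L G : ℝ) ≤ L (G.erase x) + 1 := by
        have : L G ≤ L (G.erase x) + 1 := by omega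
        exact_mod_cast this
      nlinarith
    · have : L G ≤ L (G.erase x) := hc ▸ card_le_L (Finset.subset_erase.2 ⟨hMG, hx⟩) hM
      have : (L G : ℝ) ≤ L (G.erase x) := by exact_mod_cast this
      have : (L G : ℝ) - L (G.erase x) = 0 := by linarith
      simp [this]
  calc _ ≤ ∑ x ∈ G, (if x ∈ M then (1 : ℝ) else 0) := Finset.sum_le_sum key
    _ = M.card := by
      rw [Finset.sum_ite_mem, Finset.inter_eq_right.2 hMG]; simp
    _ = L G := by rw [hc]

lemma sq_median_sub_mean_le {p : ℝ} (hp : 0 ≤ p) (hp' : p ≤ 1) {m : ℝ}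
    (hm : IsMedianW (binomW p : HG n → ℝ) (fun H => (L H : ℝ)) m) :
    (m - wExp (binomW p : HG n → ℝ) (fun H => (L H : ℝ))) ^ 2 ≤
      2 * wExp (binomW p : HG n → ℝ) (fun H => (L H : ℝ)) := by
  set E := wExp (binomW p : HG n → ℝ) (fun H => (L H : ℝ)) with hE
  have hw : ∀ H : HG n, 0 ≤ binomW p H := fun H =>
    Finset.prod_nonneg fun a _ => by split_ifs <;> linarith
  have hvar : ∑ H : HG n, binomW p H * ((L H : ℝ) - E) ^ 2 ≤ E := by
    have h := subsetExp_efronStein hp hp' (Finset.univ : HG n) (fun H => (L H : ℝ))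
    have h1 := subsetExp_mono hp hp' (s := (Finset.univ : HG n))
      (fun H _ => sum_sq_L_sub_erase_le H)
    have h2 := subsetExp_mono hp hp' (s := (Finset.univ : HG n)) (f := fun _ => 0)
      (g := fun H => ∑ x ∈ H, ((L H : ℝ) - L (H.erase x)) ^ 2)
      (fun H _ => Finset.sum_nonneg fun _ _ => sq_nonneg _)
    have h3 := subsetExp_one p (Finset.univ : HG n)
    rw [← wExp_binomW] at h h1 h2 h3
    rw [← wExp_binomW] at h h1 h2
    rw [← wExp_binomW] at h
    rw [← hE] at h h1
    have z : wExp (binomW p : HG n → ℝ) (fun _ => 0) = 0 := by simp [wExp]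
    rw [z] at h2
    have e : ∑ H : HG n, binomW p H * ((L H : ℝ) - E) ^ 2 =
        wExp (binomW p : HG n → ℝ) (fun H => (L H : ℝ) ^ 2) - 2 * E * E
          + E ^ 2 * wExp (binomW p : HG n → ℝ) (fun _ => 1) := by
      conv_rhs => rw [show 2 * E * E = 2 * E *
        wExp (binomW p : HG n → ℝ) (fun H => (L H : ℝ)) by rw [← hE]]
      simp only [wExp, Finset.mul_sum]
      rw [← Finset.sum_sub_distrib, ← Finset.sum_add_distrib]
      exact Finset.sum_congr rfl fun H _ => by ring
    rw [e, h3]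
    nlinarith [mul_nonneg hp h2]
  have cheb : ∀ A : Set (HG n), 1 / 2 ≤ wProb (binomW p) A →
      (∀ H ∈ A, (m - E) ^ 2 ≤ ((L H : ℝ) - E) ^ 2) → (m - E) ^ 2 ≤ 2 * E := by
    intro A hA h
    have : (m - E) ^ 2 * wProb (binomW p) A ≤ ∑ H : HG n, binomW p H * ((L H : ℝ) - E) ^ 2 := by
      rw [wProb, Finset.mul_sum]
      refine le_trans (Finset.sum_le_sum fun H hH => ?_)
        (Finset.sum_le_sum_of_subset_of_nonneg (Finset.filter_subset _ _)
          fun H _ _ => mul_nonneg (hw H) (sq_nonneg _))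
      rw [mul_comm]
      exact mul_le_mul_of_nonneg_left (h H (Finset.mem_filter.1 hH).2) (hw H)
    nlinarith [sq_nonneg (m - E)]
  rcases le_total m E with h | h
  · refine cheb _ hm.1 fun H hH => ?_
    have : (L H : ℝ) ≤ m := hH
    nlinarith
  · refine cheb _ hm.2 fun H hH => ?_
    have : m ≤ (L H : ℝ) := hH
    nlinarith

end Length

/-- The largest cardinality of a set whose distinct elements are pairwise related by `r` in one
of the two directions. -/
noncomputable def chainLen {ι : Type*} [Fintype ι] (r : ι → ι → Prop) : ℕ :=
  ((Finset.univ : Finset (Finset ι)).filter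
    (fun S => ∀ a ∈ S, ∀ b ∈ S, a ≠ b → r a b ∨ r b a)).sup Finset.card

section ChainLen

variable {ι κ : Type*} [Fintype ι] [Fintype κ]

lemma card_le_chainLen {r : ι → ι → Prop} {S : Finset ι}
    (h : ∀ a ∈ S, ∀ b ∈ S, a ≠ b → r a b ∨ r b a) : S.card ≤ chainLen r :=
  Finset.le_sup (f := Finset.card) (by simpa using h)

lemma exists_card_eq_chainLen (r : ι → ι → Prop) :
    ∃ S : Finset ι, (∀ a ∈ S, ∀ b ∈ S, a ≠ b → r a b ∨ r b a) ∧ S.card = chainLen r := by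
  have hne : ((Finset.univ : Finset (Finset ι)).filter
    (fun S => ∀ a ∈ S, ∀ b ∈ S, a ≠ b → r a b ∨ r b a)).Nonempty := ⟨∅, by simp⟩
  obtain ⟨S, hS, h⟩ := Finset.exists_mem_eq_sup _ hne Finset.card
  exact ⟨S, (Finset.mem_filter.1 hS).2, h.symm⟩

lemma chainLen_le_card (r : ι → ι → Prop) : chainLen r ≤ Fintype.card ι := by
  obtain ⟨S, -, h⟩ := exists_card_eq_chainLen r
  exact h ▸ Finset.card_le_univ S

lemma chainLen_mono {r s : ι → ι → Prop} (h : ∀ a b, r a b → s a b) :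
    chainLen r ≤ chainLen s := by
  obtain ⟨S, hS, hc⟩ := exists_card_eq_chainLen r
  exact hc ▸ card_le_chainLen fun a ha b hb hab => (hS a ha b hb hab).imp (h a b) (h b a)

lemma chainLen_comap_le (e : κ ↪ ι) (r : ι → ι → Prop) :
    chainLen (fun a b => r (e a) (e b)) ≤ chainLen r := by
  obtain ⟨S, hS, hc⟩ := exists_card_eq_chainLen (fun a b => r (e a) (e b))
  rw [← hc, ← Finset.card_map e]
  refine card_le_chainLen fun a' ha' b' hb' hab => ?_
  obtain ⟨a, ha, rfl⟩ := Finset.mem_map.1 ha'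
  obtain ⟨b, hb, rfl⟩ := Finset.mem_map.1 hb'
  exact hS a ha b hb fun h => hab (h ▸ rfl)

lemma chainLen_comap_equiv (e : κ ≃ ι) (r : ι → ι → Prop) :
    chainLen (fun a b => r (e a) (e b)) = chainLen r := by
  refine le_antisymm (chainLen_comap_le e.toEmbedding r) ?_
  simpa using chainLen_comap_le e.symm.toEmbedding (fun a b => r (e a) (e b))

end ChainLen

/-- The mean length of a longest common increasing subsequence of `d` independent uniform
permutations of `k` points. -/
noncomputable def permMean (d k : ℕ) : ℝ :=
  (∑ σ : Fin d → Equiv.Perm (Fin k), (chainLen (fun a b => ∀ i, σ i a < σ i b) : ℝ)) /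
    Fintype.card (Fin d → Equiv.Perm (Fin k))

lemma permMean_nonneg (d k : ℕ) : 0 ≤ permMean d k := by unfold permMean; positivity

lemma permMean_le (d k : ℕ) : permMean d k ≤ k := by
  unfold permMean
  rw [div_le_iff₀ (by exact_mod_cast Fintype.card_pos)]
  calc _ ≤ ∑ σ : Fin d → Equiv.Perm (Fin k), (k : ℝ) := by
        refine Finset.sum_le_sum fun σ _ => ?_
        have := chainLen_le_card (fun a b => ∀ i, σ i a < σ i b)
        rw [Fintype.card_fin] at this
        exact_mod_cast this
    _ = _ := by simp [mul_comm]

section Symmetrization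

variable {d k : ℕ} {ι : Type*}

lemma sum_perm_ranks [Fintype ι] [DecidableEq ι] (e : ι ≃ Fin k) (ρ : Fin d → (ι ≃ Fin k)) :
    ∑ σ : Fin d → Equiv.Perm ι, (chainLen (fun a b => ∀ i, ρ i (σ i a) < ρ i (σ i b)) : ℝ) =
      Fintype.card (Fin d → Equiv.Perm ι) * permMean d k := by
  let Φ : (Fin d → Equiv.Perm ι) ≃ (Fin d → Equiv.Perm (Fin k)) :=
    Equiv.piCongrRight fun i => Equiv.equivCongr e (ρ i)
  have h1 : ∑ σ : Fin d → Equiv.Perm ι,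
      (chainLen (fun a b => ∀ i, ρ i (σ i a) < ρ i (σ i b)) : ℝ) =
      ∑ σ : Fin d → Equiv.Perm (Fin k), (chainLen (fun a b => ∀ i, σ i a < σ i b) : ℝ) := by
    refine Fintype.sum_equiv Φ _ _ fun σ => ?_
    rw [← chainLen_comap_equiv e]
    simp [Φ, Equiv.equivCongr]
  rw [h1, permMean, Fintype.card_congr Φ, mul_div_cancel₀]
  exact_mod_cast Fintype.card_ne_zero

lemma exists_ranks {R : Type*} [LinearOrder R] (e : ι ≃ Fin k) (v : ι → R) :
    ∃ ρ : ι ≃ Fin k, (∀ a b, v a < v b → ρ a < ρ b) ∧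
      (Function.Injective v → ∀ a b, ρ a < ρ b → v a < v b) := by
  let s := Tuple.sort (v ∘ e.symm)
  have hs : Monotone ((v ∘ e.symm) ∘ s) := Tuple.monotone_sort _
  refine ⟨e.trans s.symm, fun a b h => ?_, fun hv a b h => ?_⟩
  · by_contra! h'
    have := hs h'
    simp at this
    exact absurd h (not_lt.2 this)
  · have := hs h.le
    simp at this
    refine lt_of_le_of_ne this fun hab => ?_
    exact absurd (hv hab ▸ h) (lt_irrefl _)

lemma sum_perm_chainLen_le [Fintype ι] [DecidableEq ι] {R : Fin d → Type*} [∀ i, LinearOrder (R i)] (e : ι ≃ Fin k)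
    (v : ∀ i, ι → R i) :
    ∑ σ : Fin d → Equiv.Perm ι, (chainLen (fun a b => ∀ i, v i (σ i a) < v i (σ i b)) : ℝ) ≤
      Fintype.card (Fin d → Equiv.Perm ι) * permMean d k := by
  choose ρ h1 h2 using fun i => exists_ranks e (v i)
  rw [← sum_perm_ranks e ρ]
  refine Finset.sum_le_sum fun σ _ => ?_
  have := chainLen_mono (r := fun a b => ∀ i, v i (σ i a) < v i (σ i b))
    (s := fun a b => ∀ i, ρ i (σ i a) < ρ i (σ i b)) fun a b h i => h1 i _ _ (h i)
  exact_mod_cast this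

lemma sum_perm_chainLen_eq [Fintype ι] [DecidableEq ι] {R : Fin d → Type*} [∀ i, LinearOrder (R i)] (e : ι ≃ Fin k)
    (v : ∀ i, ι → R i) (hv : ∀ i, Function.Injective (v i)) :
    ∑ σ : Fin d → Equiv.Perm ι, (chainLen (fun a b => ∀ i, v i (σ i a) < v i (σ i b)) : ℝ) =
      Fintype.card (Fin d → Equiv.Perm ι) * permMean d k := by
  choose ρ h1 h2 using fun i => exists_ranks e (v i)
  rw [← sum_perm_ranks e ρ]
  refine Finset.sum_congr rfl fun σ _ => ?_
  congr 2
  funext a b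
  exact propext ⟨fun h i => h1 i _ _ (h i), fun h i => h2 i (hv i) _ _ (h i)⟩

end Symmetrization

section Measure

variable {d m : ℕ}

lemma cubeChain_eq_chainLen (x : Fin m → Fin d → ℝ) :
    cubeChain d m x = chainLen fun a b => ∀ i, x a i < x b i := by
  unfold cubeChain chainLen
  congr

lemma unitCube_eq_pi : unitCube d m =
    Set.pi Set.univ fun _ : Fin m => Set.pi Set.univ fun _ : Fin d => Set.Icc (0 : ℝ) 1 := by
  ext x
  simp only [unitCube, Set.mem_pi, Set.mem_univ, forall_true_left]
  rfl

lemma volume_unitCube : volume (unitCube d m) = 1 := by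
  rw [unitCube_eq_pi, volume_pi_pi]
  simp only [volume_pi_pi]
  simp

lemma measurableSet_unitCube : MeasurableSet (unitCube d m) := by
  rw [unitCube_eq_pi]
  exact MeasurableSet.univ_pi fun _ => MeasurableSet.univ_pi fun _ => measurableSet_Icc

/-- Permuting the points separately in every coordinate. -/
def permuteCoords (σ : Fin d → Equiv.Perm (Fin m)) :
    (Fin m → Fin d → ℝ) ≃L[ℝ] (Fin m → Fin d → ℝ) where
  toFun x a i := x (σ i a) i
  invFun x a i := x ((σ i).symm a) i
  map_add' _ _ := rfl
  map_smul' _ _ := rfl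
  left_inv x := by simp
  right_inv x := by simp
  continuous_toFun := by fun_prop
  continuous_invFun := by fun_prop

lemma preimage_permuteCoords_unitCube (σ : Fin d → Equiv.Perm (Fin m)) :
    permuteCoords σ ⁻¹' unitCube d m = unitCube d m := by
  ext x
  refine ⟨fun h a i => ?_, fun h a i => h (σ i a) i⟩
  simpa [permuteCoords] using h ((σ i).symm a) i

lemma measurePreserving_permuteCoords (σ : Fin d → Equiv.Perm (Fin m)) :
    MeasurePreserving (permuteCoords σ) := by
  refine ⟨(permuteCoords σ).continuous.measurable, ?_⟩
  have hpre := preimage_permuteCoords_unitCube σ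
  have : (volume : Measure (Fin m → Fin d → ℝ)).IsAddHaarMeasure := 
    Measure.pi.isAddHaarMeasure _
  have : (volume.map (permuteCoords σ)).IsAddHaarMeasure :=
    (permuteCoords σ).isAddHaarMeasure_map _
  have h := Measure.isAddLeftInvariant_eq_smul (volume.map (permuteCoords σ))
    (volume : Measure (Fin m → Fin d → ℝ))
  have h1 := congrArg (fun μ => μ (unitCube d m)) h
  simp only [Measure.smul_apply] at h1
  rw [Measure.map_apply (permuteCoords σ).continuous.measurable measurableSet_unitCube, hpre,
    volume_unitCube, ENNReal.smul_def, smul_eq_mul, mul_one] at h1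
  rw [h]
  have : Measure.addHaarScalarFactor (volume.map (permuteCoords σ))
    (volume : Measure (Fin m → Fin d → ℝ)) = 1 := by exact_mod_cast h1.symm
  simp [this]

lemma ae_coords_injective :
    ∀ᵐ x : Fin m → Fin d → ℝ, ∀ i, Function.Injective fun a => x a i := by
  rw [ae_all_iff]
  intro i
  have : ∀ a b : Fin m, a ≠ b → ∀ᵐ x : Fin m → Fin d → ℝ, x a i ≠ x b i := by
    intro a b hab
    let s : Submodule ℝ (Fin m → Fin d → ℝ) :=
      { carrier := {x | x a i = x b i}
        add_mem' := by intro x y hx hy; simp_all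
        zero_mem' := by simp
        smul_mem' := by intro c x hx; simp_all }
    have hs : s ≠ ⊤ := by
      intro h
      have : (fun c _ => if c = a then (1 : ℝ) else 0) ∈ s := h ▸ Submodule.mem_top
      have h2 : (if a = a then (1 : ℝ) else 0) = if b = a then (1 : ℝ) else 0 := this
      simp [hab.symm] at h2
    have := Measure.addHaar_submodule volume s hs
    rw [ae_iff]
    simpa [s] using this
  have h2 : ∀ᵐ x : Fin m → Fin d → ℝ, ∀ a b : Fin m, a ≠ b → x a i ≠ x b i := by
    simp only [ae_all_iff]
    exact fun a b h => this a b h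
  filter_upwards [h2] with x hx a b hab
  by_contra hne
  exact hx a b hne hab

lemma measurable_cubeChain : Measurable (cubeChain d m) := by
  let P : (Fin m → Fin d → ℝ) → Fin m → Fin m → Prop := fun x a b => ∀ i, x a i < x b i
  have hP : Measurable P := by
    refine measurable_pi_iff.2 fun a => measurable_pi_iff.2 fun b => ?_
    refine Measurable.forall fun i => measurableSet_setOfPred.1 ?_
    exact measurableSet_lt (by fun_prop) (by fun_prop)
  have hc : Measurable (fun r : Fin m → Fin m → Prop => chainLen r) := Measurable.of_discrete
  have : cubeChain d m = (fun r : Fin m → Fin m → Prop => chainLen r) ∘ P :=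
    funext cubeChain_eq_chainLen
  exact this ▸ hc.comp hP

lemma integral_cubeChain :
    ∫ x in unitCube d m, (cubeChain d m x : ℝ) = permMean d m := by
  have hint : IntegrableOn (fun x => (cubeChain d m x : ℝ)) (unitCube d m) := by
    refine Measure.integrableOn_of_bounded (M := m) (by simp [volume_unitCube]) ?_ ?_
    · exact (measurable_from_top.comp measurable_cubeChain).aestronglyMeasurable
    · refine Filter.Eventually.of_forall fun x => ?_
      have := chainLen_le_card (fun a b => ∀ i, x a i < x b i)
      rw [Fintype.card_fin] at this
      rw [← cubeChain_eq_chainLen] at this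
      simpa using this
  have hpre := preimage_permuteCoords_unitCube (d := d) (m := m)
  have hemb : ∀ σ : Fin d → Equiv.Perm (Fin m), MeasurableEmbedding (permuteCoords σ) := fun σ =>
    (permuteCoords σ).toHomeomorph.measurableEmbedding
  have hσ : ∀ σ : Fin d → Equiv.Perm (Fin m),
      ∫ x in unitCube d m, (cubeChain d m (permuteCoords σ x) : ℝ) =
        ∫ x in unitCube d m, (cubeChain d m x : ℝ) := by
    intro σ
    have := (measurePreserving_permuteCoords σ).setIntegral_preimage_emb (hemb σ)
      (fun x => (cubeChain d m x : ℝ)) (unitCube d m)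
    rwa [hpre] at this
  have hintσ : ∀ σ : Fin d → Equiv.Perm (Fin m),
      IntegrableOn (fun x => (cubeChain d m (permuteCoords σ x) : ℝ)) (unitCube d m) := by
    intro σ
    have := ((measurePreserving_permuteCoords σ).integrableOn_comp_preimage (hemb σ)
      (f := fun x => (cubeChain d m x : ℝ)) (s := unitCube d m)).2 hint
    rwa [hpre] at this
  have hsum : ∑ σ : Fin d → Equiv.Perm (Fin m),
      ∫ x in unitCube d m, (cubeChain d m (permuteCoords σ x) : ℝ) =
      Fintype.card (Fin d → Equiv.Perm (Fin m)) * permMean d m := by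
    rw [← integral_finsetSum _ fun σ _ => hintσ σ]
    have : ∀ᵐ x ∂(volume.restrict (unitCube d m)), ∑ σ : Fin d → Equiv.Perm (Fin m),
        (cubeChain d m (permuteCoords σ x) : ℝ) =
          Fintype.card (Fin d → Equiv.Perm (Fin m)) * permMean d m := by
      filter_upwards [ae_restrict_of_ae ae_coords_injective] with x hx
      simp only [cubeChain_eq_chainLen]
      exact sum_perm_chainLen_eq (Equiv.refl (Fin m)) (fun i a => x a i) hx
    rw [integral_congr_ae this]
    simp [measureReal_def, volume_unitCube]
  simp only [hσ, Finset.sum_const, Finset.card_univ, nsmul_eq_mul] at hsum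
  exact mul_left_cancel₀ (by exact_mod_cast Fintype.card_ne_zero) hsum

end Measure

section Sampling

variable {d : ℕ} {n : Fin d → ℕ} {m : ℕ}

lemma L_image_le_chainLen (v : Fin m → Edge n) :
    L (Finset.univ.image v) ≤ chainLen fun a b => ∀ i, v a i < v b i := by
  obtain ⟨M, hM, hc, hcard⟩ := exists_card_eq_L (Finset.univ.image v)
  rcases M.eq_empty_or_nonempty with rfl | ⟨e₀, he₀⟩
  · simp [← hcard]
  obtain ⟨a₀, -, -⟩ := Finset.mem_image.1 (hM he₀)
  have : Nonempty (Fin m) := ⟨a₀⟩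
  choose! g hg using fun e (he : e ∈ M) => Finset.mem_image.1 (hM he)
  have hinj : Set.InjOn g M := fun e he f hf h => by
    rw [← (hg e he).2, ← (hg f hf).2, h]
  rw [← hcard, ← Finset.card_image_of_injOn hinj]
  refine card_le_chainLen fun a ha b hb hab => ?_
  obtain ⟨e, he, rfl⟩ := Finset.mem_image.1 ha
  obtain ⟨f, hf, rfl⟩ := Finset.mem_image.1 hb
  rw [(hg e he).2, (hg f hf).2]
  exact hc e he f hf fun h => hab (h ▸ rfl)

lemma chainLen_le_L_image (hd : 0 < d) (v : Fin m → Edge n) :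
    (chainLen fun a b => ∀ i, v a i < v b i) ≤ L (Finset.univ.image v) := by
  obtain ⟨S, hS, hcard⟩ := exists_card_eq_chainLen fun a b => ∀ i, v a i < v b i
  have hinj : Set.InjOn v S := fun a ha b hb h => by
    by_contra hab
    rcases hS a ha b hb hab with h' | h' <;> exact absurd (h' ⟨0, hd⟩) (by rw [h]; exact lt_irrefl _)
  rw [← hcard, ← Finset.card_image_of_injOn hinj]
  refine card_le_L (Finset.image_subset_image (Finset.subset_univ S)) fun e he f hf hef => ?_
  obtain ⟨a, ha, rfl⟩ := Finset.mem_image.1 he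
  obtain ⟨b, hb, rfl⟩ := Finset.mem_image.1 hf
  exact hS a ha b hb fun h => hef (h ▸ rfl)

/-- Permuting, separately in every coordinate, the sampled edges whose index lies in `J`. -/
def permuteSample (n : Fin d → ℕ) (J : Finset (Fin m)) (σ : Fin d → Equiv.Perm J) :
    (Fin m → Edge n) ≃ (Fin m → Edge n) where
  toFun v a i := v (Equiv.Perm.ofSubtype (σ i) a) i
  invFun v a i := v ((Equiv.Perm.ofSubtype (σ i)).symm a) i
  left_inv v := by simp
  right_inv v := by simp

lemma sum_chainLen_eq_sum_perm (J : Finset (Fin m)) (A : Finset (Fin m → Edge n))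
    (hA : ∀ σ v, v ∈ A ↔ permuteSample n J σ v ∈ A) :
    Fintype.card (Fin d → Equiv.Perm J) *
        ∑ v ∈ A, (chainLen (fun a b : J => ∀ i, v a i < v b i) : ℝ) =
      ∑ v ∈ A, ∑ σ : Fin d → Equiv.Perm J,
        (chainLen (fun a b : J => ∀ i, v (σ i a) i < v (σ i b) i) : ℝ) := by
  rw [Finset.sum_comm, ← nsmul_eq_mul, ← Finset.card_univ, ← Finset.sum_const]
  refine Finset.sum_congr rfl fun σ _ => ?_
  refine (Finset.sum_equiv (permuteSample n J σ) (hA σ) fun v _ => ?_).symm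
  simp [permuteSample]

lemma sum_chainLen_le (J : Finset (Fin m)) (A : Finset (Fin m → Edge n))
    (hA : ∀ σ v, v ∈ A ↔ permuteSample n J σ v ∈ A) :
    ∑ v ∈ A, (chainLen (fun a b : J => ∀ i, v a i < v b i) : ℝ) ≤ A.card * permMean d J.card := by
  have h := sum_chainLen_eq_sum_perm J A hA
  have h2 : ∑ v ∈ A, ∑ σ : Fin d → Equiv.Perm J,
        (chainLen (fun a b : J => ∀ i, v (σ i a) i < v (σ i b) i) : ℝ) ≤
      ∑ v ∈ A, Fintype.card (Fin d → Equiv.Perm J) * permMean d J.card :=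
    Finset.sum_le_sum fun v _ =>
      sum_perm_chainLen_le J.equivFin (fun i (a : J) => v a i)
  have hpos : (0 : ℝ) < Fintype.card (Fin d → Equiv.Perm J) := by
    exact_mod_cast Fintype.card_pos
  rw [← h, Finset.sum_const, nsmul_eq_mul, mul_left_comm] at h2
  exact le_of_mul_le_mul_left h2 hpos

lemma sum_chainLen_eq (J : Finset (Fin m)) (A : Finset (Fin m → Edge n))
    (hA : ∀ σ v, v ∈ A ↔ permuteSample n J σ v ∈ A)
    (hinj : ∀ v ∈ A, ∀ i, Function.Injective fun a : J => v a i) :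
    ∑ v ∈ A, (chainLen (fun a b : J => ∀ i, v a i < v b i) : ℝ) = A.card * permMean d J.card := by
  have h := sum_chainLen_eq_sum_perm J A hA
  have h2 : ∑ v ∈ A, ∑ σ : Fin d → Equiv.Perm J,
        (chainLen (fun a b : J => ∀ i, v (σ i a) i < v (σ i b) i) : ℝ) =
      ∑ v ∈ A, Fintype.card (Fin d → Equiv.Perm J) * permMean d J.card :=
    Finset.sum_congr rfl fun v hv =>
      sum_perm_chainLen_eq J.equivFin (fun i (a : J) => v a i) (hinj v hv)
  have hpos : (0 : ℝ) < Fintype.card (Fin d → Equiv.Perm J) := by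
    exact_mod_cast Fintype.card_pos
  rw [← h, Finset.sum_const, nsmul_eq_mul, mul_left_comm] at h2
  exact mul_left_cancel₀ hpos.ne' h2

lemma sum_L_image_le :
    ∑ v : Fin m → Edge n, (L (Finset.univ.image v) : ℝ) ≤
      (Fintype.card (Edge n) : ℝ) ^ m * permMean d m := by
  have h := sum_chainLen_le (n := n) (Finset.univ : Finset (Fin m)) Finset.univ (by simp)
  simp only [Finset.card_univ, Fintype.card_pi, Finset.prod_const, Fintype.card_fin] at h
  rw [Fintype.card_pi]
  simp only [Fintype.card_fin]
  push_cast at h ⊢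
  refine le_trans (Finset.sum_le_sum fun v _ => ?_) h
  have := L_image_le_chainLen v
  rw [← chainLen_comap_equiv (Equiv.subtypeUnivEquiv (p := (· ∈ (Finset.univ : Finset (Fin m))))
    Finset.mem_univ)] at this
  exact_mod_cast this

/-- The indices of the sampled edges which share no vertex with any other sampled edge. -/
noncomputable def isolatedIndices (v : Fin m → Edge n) : Finset (Fin m) :=
  Finset.univ.filter fun a => ∀ i, ∀ b, v b i = v a i → b = a

lemma mem_isolatedIndices {v : Fin m → Edge n} {a : Fin m} :
    a ∈ isolatedIndices v ↔ ∀ i, ∀ b, v b i = v a i → b = a := by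
  simp [isolatedIndices]

lemma isolatedIndices_permuteSample {v : Fin m → Edge n} {J : Finset (Fin m)}
    (hv : isolatedIndices v = J) (σ : Fin d → Equiv.Perm J) :
    isolatedIndices (permuteSample n J σ v) = J := by
  ext a
  rw [mem_isolatedIndices]
  constructor
  · intro h
    by_contra ha
    have ha' := ha
    rw [← hv, mem_isolatedIndices] at ha'
    push Not at ha'
    obtain ⟨i, b, hb, hba⟩ := ha'
    have hbJ : b ∉ J := by
      rw [← hv, mem_isolatedIndices]
      exact fun hb' => hba (hb' i a hb.symm).symm
    refine hba (h i b ?_)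
    simp only [permuteSample, Equiv.coe_fn_mk]
    rw [Equiv.Perm.ofSubtype_apply_of_not_mem _ hbJ, Equiv.Perm.ofSubtype_apply_of_not_mem _ ha, hb]
  · intro ha i b hb
    simp only [permuteSample, Equiv.coe_fn_mk] at hb
    have : Equiv.Perm.ofSubtype (σ i) a ∈ isolatedIndices v := by
      rw [hv]
      exact (Equiv.Perm.ofSubtype_apply_mem_iff_mem (σ i) a).2 ha
    exact (Equiv.Perm.ofSubtype (σ i)).injective (mem_isolatedIndices.1 this i _ hb)

lemma sum_permMean_isolated_le (hd : 0 < d) :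
    ∑ v : Fin m → Edge n, permMean d (isolatedIndices v).card ≤
      ∑ v : Fin m → Edge n, (L (Finset.univ.image v) : ℝ) := by
  have h1 : ∑ v : Fin m → Edge n, permMean d (isolatedIndices v).card =
      ∑ v : Fin m → Edge n,
        (chainLen (fun a b : isolatedIndices v => ∀ i, v a i < v b i) : ℝ) := by
    refine (Finset.sum_fiberwise _ isolatedIndices _).symm.trans (Eq.trans
      (Finset.sum_congr rfl fun J _ => ?_) (Finset.sum_fiberwise _ isolatedIndices _))
    have h := sum_chainLen_eq J (Finset.univ.filter fun v : Fin m → Edge n => isolatedIndices v = J)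
      (fun σ v => by
        simp only [Finset.mem_filter, Finset.mem_univ, true_and]
        refine ⟨fun hv => isolatedIndices_permuteSample hv σ, fun hv => ?_⟩
        have := isolatedIndices_permuteSample hv fun i => (σ i).symm
        rw [← this]
        congr 1
        funext a i
        have : Equiv.Perm.ofSubtype (σ i).symm = (Equiv.Perm.ofSubtype (σ i)).symm :=
          map_inv Equiv.Perm.ofSubtype (σ i)
        simp [permuteSample, this])
      (fun v hv i a b hab => by
        have hv : isolatedIndices v = J := (Finset.mem_filter.1 hv).2
        have hb : (b : Fin m) ∈ isolatedIndices v := hv ▸ b.2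
        exact Subtype.ext (mem_isolatedIndices.1 hb i a hab))
    rw [Finset.sum_congr rfl (g := fun _ => permMean d J.card)
      fun v hv => by rw [(Finset.mem_filter.1 hv).2], Finset.sum_const, nsmul_eq_mul, ← h]
    refine Finset.sum_congr rfl fun v hv => ?_
    obtain rfl := (Finset.mem_filter.1 hv).2
    rfl
  rw [h1]
  refine Finset.sum_le_sum fun v _ => ?_
  have := (chainLen_comap_le (Function.Embedding.subtype (· ∈ isolatedIndices v))
    fun a b => ∀ i, v a i < v b i).trans (chainLen_le_L_image hd v)
  exact_mod_cast this

lemma mul_card_collision (hn : ∀ i, 0 < n i) {a b : Fin m} (hab : a ≠ b) (i : Fin d) :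
    (n i : ℝ) * ∑ v : Fin m → Edge n, (if v b i = v a i then (1 : ℝ) else 0) =
      (Fintype.card (Edge n) : ℝ) ^ m := by
  have : ∀ i, NeZero (n i) := fun i => ⟨(hn i).ne'⟩
  have h : ∀ c : Fin (n i), ∑ v : Fin m → Edge n, (if v b i = v a i then (1 : ℝ) else 0) =
      ∑ v : Fin m → Edge n, (if c = v a i - v b i then (1 : ℝ) else 0) := by
    intro c
    refine (Fintype.sum_equiv (Equiv.piCongrRight fun a' => Equiv.piCongrRight fun i' =>
      if a' = b then Equiv.addRight (Fin.ofNat (n i') c) else Equiv.refl _) _ _ fun v => ?_).symm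
    simp [hab, eq_sub_iff_add_eq, add_comm c]
  calc _ = ∑ c : Fin (n i), ∑ v : Fin m → Edge n, (if c = v a i - v b i then (1 : ℝ) else 0) := by
        rw [← Finset.sum_congr rfl fun c _ => h c]; simp
    _ = _ := by rw [Finset.sum_comm]; simp

lemma sum_not_isolated_le (hn : ∀ i, 0 < n i) :
    ∑ v : Fin m → Edge n, ((m : ℝ) - (isolatedIndices v).card) ≤
      (Fintype.card (Edge n) : ℝ) ^ m * (m * (m - 1) * ∑ i, (1 / n i : ℝ)) := by
  have h : ∀ v : Fin m → Edge n, (m : ℝ) - (isolatedIndices v).card ≤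
      ∑ a : Fin m, ∑ b ∈ Finset.univ.erase a, ∑ i, (if v b i = v a i then (1 : ℝ) else 0) := by
    intro v
    have hm : (m : ℝ) = ∑ a : Fin m, (1 : ℝ) := by simp
    have hJ : ((isolatedIndices v).card : ℝ) =
        ∑ a : Fin m, (if a ∈ isolatedIndices v then (1 : ℝ) else 0) := by simp
    rw [hJ, hm, ← Finset.sum_sub_distrib]
    refine Finset.sum_le_sum fun a _ => ?_
    have hnn : ∀ b i, (0 : ℝ) ≤ if v b i = v a i then (1 : ℝ) else 0 := fun b i => by
      split_ifs <;> norm_num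
    split_ifs with ha
    · rw [sub_self]
      exact Finset.sum_nonneg fun b _ => Finset.sum_nonneg fun i _ => hnn b i
    · rw [mem_isolatedIndices] at ha
      push Not at ha
      obtain ⟨i, b, hb, hba⟩ := ha
      calc (1 : ℝ) - 0 = if v b i = v a i then (1 : ℝ) else 0 := by simp [hb]
        _ ≤ ∑ i, (if v b i = v a i then (1 : ℝ) else 0) :=
          Finset.single_le_sum (f := fun i => if v b i = v a i then (1 : ℝ) else 0)
            (fun i _ => hnn b i) (Finset.mem_univ i)
        _ ≤ _ := Finset.single_le_sum
            (f := fun b => ∑ i, if v b i = v a i then (1 : ℝ) else 0)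
            (fun b _ => Finset.sum_nonneg fun i _ => hnn b i)
            (Finset.mem_erase.2 ⟨hba, Finset.mem_univ b⟩)
  refine (Finset.sum_le_sum fun v _ => h v).trans (le_of_eq ?_)
  rw [Finset.sum_comm]
  have h2 : ∀ a : Fin m, ∑ v : Fin m → Edge n, ∑ b ∈ Finset.univ.erase a, ∑ i,
      (if v b i = v a i then (1 : ℝ) else 0) =
      ((m : ℝ) - 1) * ((Fintype.card (Edge n) : ℝ) ^ m * ∑ i, (1 / n i : ℝ)) := by
    intro a
    rw [Finset.sum_comm]
    have hm : 1 ≤ m := by have := a.2; omega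
    have : ∀ b ∈ Finset.univ.erase a, ∑ v : Fin m → Edge n, ∑ i,
        (if v b i = v a i then (1 : ℝ) else 0) =
        (Fintype.card (Edge n) : ℝ) ^ m * ∑ i, (1 / n i : ℝ) := by
      intro b hb
      rw [Finset.sum_comm, Finset.mul_sum]
      refine Finset.sum_congr rfl fun i _ => ?_
      rw [← mul_card_collision hn (Finset.ne_of_mem_erase hb).symm i]
      have : (n i : ℝ) ≠ 0 := by exact_mod_cast (hn i).ne'
      field_simp
    rw [Finset.sum_congr rfl this, Finset.sum_const, Finset.card_erase_of_mem (Finset.mem_univ a)]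
    simp [Nat.cast_sub hm]
  rw [Finset.sum_congr rfl fun a _ => h2 a]
  simp
  ring

end Sampling

section Poisson

lemma hasSum_exp_pow (μ : ℝ) (k : ℕ) :
    HasSum (fun m : ℕ => μ ^ m / m.factorial * (k : ℝ) ^ m) (Real.exp μ ^ k) := by
  have h := NormedSpace.expSeries_div_hasSum_exp (μ * k)
  rw [← Real.exp_eq_exp_ℝ] at h
  rw [← Real.exp_nat_mul, mul_comm (k : ℝ)]
  refine h.congr_fun fun m => ?_
  rw [mul_pow]; ring

variable {E : Type*} [Fintype E] [DecidableEq E]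

lemma sum_card_image_eq (m : ℕ) (H : Finset E) :
    ∑ G ∈ H.powerset, ((Finset.univ.filter fun v : Fin m → E => Finset.univ.image v = G).card : ℝ) =
      (H.card : ℝ) ^ m := by
  have h := Finset.card_eq_sum_card_fiberwise (f := fun v : Fin m → E => Finset.univ.image v)
    (s := Fintype.piFinset fun _ : Fin m => H) (t := H.powerset) (fun v hv => by
      have hv := Fintype.mem_piFinset.1 hv
      exact Finset.mem_coe.2 (Finset.mem_powerset.2 (Finset.image_subset_iff.2 fun a _ => hv a)))
  rw [Fintype.card_piFinset_const] at h
  have h2 : ∀ G ∈ H.powerset,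
      (Finset.univ.filter fun v : Fin m → E => Finset.univ.image v = G) =
      (Fintype.piFinset fun _ : Fin m => H).filter fun v => Finset.univ.image v = G := by
    intro G hG
    ext v
    simp only [Finset.mem_filter, Finset.mem_univ, true_and, Fintype.mem_piFinset]
    refine ⟨fun hv => ⟨fun a => ?_, hv⟩, fun hv => hv.2⟩
    exact Finset.mem_powerset.1 hG (hv ▸ Finset.mem_image_of_mem v (Finset.mem_univ a))
  rw [Finset.sum_congr rfl fun G hG => by rw [h2 G hG]]
  exact_mod_cast h.symm

/-- The exponential generating function of the number of maps onto a finite set. -/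
lemma hasSum_card_image_eq (μ : ℝ) (H : Finset E) :
    HasSum (fun m : ℕ => μ ^ m / m.factorial *
      ((Finset.univ.filter fun v : Fin m → E => Finset.univ.image v = H).card : ℝ))
      ((Real.exp μ - 1) ^ H.card) := by
  induction H using Finset.strongInduction with
  | H H ih =>
    have h1 := hasSum_exp_pow μ H.card
    have h2 := hasSum_sum fun G (hG : G ∈ H.ssubsets) => ih G (Finset.mem_ssubsets.1 hG)
    have h3 := h1.sub h2
    have e : ∀ g : Finset E → ℝ, ∑ G ∈ H.powerset, g G - ∑ G ∈ H.ssubsets, g G = g H := by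
      intro g
      rw [Finset.ssubsets, ← Finset.add_sum_erase _ _ (Finset.mem_powerset_self H)]
      ring
    have h4 : Real.exp μ ^ H.card = ∑ G ∈ H.powerset, (Real.exp μ - 1) ^ G.card := by
      have := Finset.sum_pow_mul_eq_add_pow (Real.exp μ - 1) 1 H
      simp only [one_pow, mul_one, sub_add_cancel] at this
      exact this.symm
    rw [h4, e] at h3
    refine h3.congr_fun fun m => ?_
    rw [← sum_card_image_eq, Finset.mul_sum, e]

lemma hasSum_poisson_sampling [Nonempty E] {p : ℝ} (hp : p < 1) (f : Finset E → ℝ) :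
    HasSum (fun m : ℕ => Real.exp (Fintype.card E * Real.log (1 - p)) *
      ((-Real.log (1 - p)) ^ m / m.factorial * ∑ v : Fin m → E, f (Finset.univ.image v)))
      (wExp (binomW p) f) := by
  set μ := -Real.log (1 - p) with hμ
  have hq : Real.exp μ * (1 - p) = 1 := by
    rw [hμ, Real.exp_neg, Real.exp_log (by linarith)]
    exact inv_mul_cancel₀ (by linarith)
  have h := (hasSum_sum (s := Finset.univ) fun (H : Finset E) _ =>
    (hasSum_card_image_eq μ H).mul_right (f H)).mul_left
      (Real.exp (Fintype.card E * Real.log (1 - p)))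
  have e2 : Real.exp (Fintype.card E * Real.log (1 - p)) *
      ∑ H : Finset E, (Real.exp μ - 1) ^ H.card * f H = wExp (binomW p) f := by
    rw [wExp, Finset.mul_sum]
    refine Finset.sum_congr rfl fun H _ => ?_
    rw [← mul_assoc]
    congr 1
    have hb : binomW p H = p ^ H.card * (1 - p) ^ Hᶜ.card := by
      rw [binomW, ← Finset.prod_mul_prod_compl H, ← Finset.prod_const, ← Finset.prod_const]
      exact congrArg₂ _ (Finset.prod_congr rfl fun a ha => if_pos ha)
        (Finset.prod_congr rfl fun a ha => if_neg (Finset.mem_compl.1 ha))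
    rw [hb, Real.exp_nat_mul, Real.exp_log (by linarith), ← Finset.card_add_card_compl H, pow_add,
      mul_right_comm, ← mul_pow]
    congr 2
    linarith
  rw [e2] at h
  refine h.congr_fun fun m => ?_
  congr 1
  rw [← Finset.sum_fiberwise Finset.univ (fun v : Fin m → E => Finset.univ.image v), Finset.mul_sum]
  refine Finset.sum_congr rfl fun H _ => ?_
  rw [Finset.sum_congr rfl (g := fun _ => f H) fun v hv => by rw [(Finset.mem_filter.1 hv).2],
    Finset.sum_const, nsmul_eq_mul, mul_assoc]

lemma hasSum_poisson_quadratic (l α β γ : ℝ) :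
    HasSum (fun m : ℕ => Real.exp (-l) * (l ^ m / m.factorial * (α + β * m + γ * (m * (m - 1)))))
      (α + β * l + γ * l ^ 2) := by
  have h0 : HasSum (fun m : ℕ => l ^ m / m.factorial) (Real.exp l) := by
    simpa using hasSum_exp_pow l 1
  have h1 : HasSum (fun m : ℕ => l ^ m / m.factorial * m) (l * Real.exp l) := by
    rw [← hasSum_nat_add_iff' 1]
    simp only [Finset.range_one, Finset.sum_singleton, Nat.cast_zero, mul_zero, sub_zero]
    refine (h0.mul_left l).congr_fun fun m => ?_
    rw [Nat.factorial_succ]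
    have : (m.factorial : ℝ) ≠ 0 := by positivity
    push_cast
    field_simp
    ring
  have h2 : HasSum (fun m : ℕ => l ^ m / m.factorial * (m * (m - 1))) (l ^ 2 * Real.exp l) := by
    rw [← hasSum_nat_add_iff' 1]
    simp only [Finset.range_one, Finset.sum_singleton, Nat.cast_zero, zero_mul, mul_zero, sub_zero]
    rw [show l ^ 2 * Real.exp l = l * (l * Real.exp l) by ring]
    refine (h1.mul_left l).congr_fun fun m => ?_
    rw [Nat.factorial_succ]
    have : (m.factorial : ℝ) ≠ 0 := by positivity
    push_cast
    field_simp
    ring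
  have h := (((h0.mul_left α).add (h1.mul_left β)).add (h2.mul_left γ)).mul_left (Real.exp (-l))
  have e : Real.exp (-l) * (α * Real.exp l + β * (l * Real.exp l) + γ * (l ^ 2 * Real.exp l)) =
      α + β * l + γ * l ^ 2 := by
    have : Real.exp (-l) * Real.exp l = 1 := by rw [← Real.exp_add]; simp
    linear_combination (α + β * l + γ * l ^ 2) * this
  rw [e] at h
  exact h.congr_fun fun m => by ring

end Poisson

section Comparison

variable {d : ℕ} {n : Fin d → ℕ} {p : ℝ}

lemma hasSum_poisson_L (hn : ∀ i, 0 < n i) (hp : p < 1) :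
    HasSum (fun m : ℕ => Real.exp (-(-(Fintype.card (Edge n) * Real.log (1 - p)))) *
      ((-(Fintype.card (Edge n) * Real.log (1 - p))) ^ m / m.factorial *
      ((∑ v : Fin m → Edge n, (L (Finset.univ.image v) : ℝ)) / (Fintype.card (Edge n) : ℝ) ^ m)))
      (wExp (binomW p : HG n → ℝ) fun H => (L H : ℝ)) := by
  have : Nonempty (Edge n) := ⟨fun i => ⟨0, hn i⟩⟩
  have hc : (Fintype.card (Edge n) : ℝ) ≠ 0 := by exact_mod_cast Fintype.card_ne_zero
  refine (hasSum_poisson_sampling hp fun H : HG n => (L H : ℝ)).congr_fun fun m => ?_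
  rw [neg_neg, ← mul_neg, mul_pow]
  congr 1
  field_simp

lemma wExp_L_le (hn : ∀ i, 0 < n i) (hp0 : 0 ≤ p) (hp : p < 1) {α β : ℝ}
    (h : ∀ m : ℕ, permMean d m ≤ α + β * m) :
    wExp (binomW p : HG n → ℝ) (fun H => (L H : ℝ)) ≤
      α + β * -(Fintype.card (Edge n) * Real.log (1 - p)) := by
  set l := -(Fintype.card (Edge n) * Real.log (1 - p)) with hl
  have hl0 : 0 ≤ l := by
    have := Real.log_nonpos (by linarith : 0 ≤ 1 - p) (by linarith)
    rw [hl, ← mul_neg]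
    exact mul_nonneg (Nat.cast_nonneg _) (by linarith)
  have h2 := hasSum_poisson_quadratic l α β 0
  simp only [zero_mul, add_zero] at h2
  refine hasSum_le (fun m => ?_) (hasSum_poisson_L hn hp) h2
  refine mul_le_mul_of_nonneg_left (mul_le_mul_of_nonneg_left ?_ (by positivity)) (by positivity)
  have : Nonempty (Edge n) := ⟨fun i => ⟨0, hn i⟩⟩
  have hc : (0 : ℝ) < Fintype.card (Edge n) := by exact_mod_cast Fintype.card_pos
  rw [div_le_iff₀ (by positivity), mul_comm]
  exact sum_L_image_le.trans (mul_le_mul_of_nonneg_left (h m) (by positivity))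

lemma le_wExp_L (hd : 0 < d) (hn : ∀ i, 0 < n i) (hp0 : 0 ≤ p) (hp : p < 1) {α β γ D : ℝ}
    (hD : 0 ≤ D) (h : ∀ m k : ℕ, k ≤ m →
      α + β * m + γ * (m * (m - 1)) - D * (m - k) ≤ permMean d k) :
    α + β * -(Fintype.card (Edge n) * Real.log (1 - p)) +
        (γ - D * ∑ i, (1 / n i : ℝ)) * (-(Fintype.card (Edge n) * Real.log (1 - p))) ^ 2 ≤
      wExp (binomW p : HG n → ℝ) (fun H => (L H : ℝ)) := by
  set l := -(Fintype.card (Edge n) * Real.log (1 - p)) with hl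
  have hl0 : 0 ≤ l := by
    have := Real.log_nonpos (by linarith : 0 ≤ 1 - p) (by linarith)
    rw [hl, ← mul_neg]
    exact mul_nonneg (Nat.cast_nonneg _) (by linarith)
  refine hasSum_le (fun m => ?_) (hasSum_poisson_quadratic l α β (γ - D * ∑ i, (1 / n i : ℝ)))
    (hasSum_poisson_L hn hp)
  refine mul_le_mul_of_nonneg_left (mul_le_mul_of_nonneg_left ?_ (by positivity)) (by positivity)
  have : Nonempty (Edge n) := ⟨fun i => ⟨0, hn i⟩⟩
  have hc : (0 : ℝ) < Fintype.card (Edge n) := by exact_mod_cast Fintype.card_pos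
  rw [le_div_iff₀ (by positivity)]
  refine le_trans ?_ (sum_permMean_isolated_le hd)
  have h1 : ∑ v : Fin m → Edge n, (α + β * m + γ * (m * (m - 1)) -
      D * (m - (isolatedIndices v).card)) ≤
      ∑ v : Fin m → Edge n, permMean d (isolatedIndices v).card :=
    Finset.sum_le_sum fun v _ => h m _ ((Finset.card_le_univ _).trans_eq (Fintype.card_fin m))
  refine le_trans ?_ h1
  rw [Finset.sum_sub_distrib, ← Finset.mul_sum, Finset.sum_const, Finset.card_univ, nsmul_eq_mul,
    Fintype.card_fun, Fintype.card_fin]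
  push_cast
  have h2 := mul_le_mul_of_nonneg_left (sum_not_isolated_le (n := n) (m := m) hn) hD
  linarith

end Comparison

section Asymptotics

variable {d : ℕ} {c : ℝ}

lemma tendsto_permMean (h : IsBWConstant d c) :
    Filter.Tendsto (fun m : ℕ => permMean d m / (m : ℝ) ^ (1 / (d : ℝ))) Filter.atTop (nhds c) := by
  simpa only [IsBWConstant, integral_cubeChain] using h

lemma IsBWConstant.nonneg (h : IsBWConstant d c) : 0 ≤ c :=
  ge_of_tendsto' (tendsto_permMean h) fun m => div_nonneg (permMean_nonneg d m) (by positivity)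

lemma exists_permMean_bounds (hd : 0 < d) (h : IsBWConstant d c) {ε : ℝ} (hε : 0 < ε) :
    ∃ K : ℝ, 0 ≤ K ∧ ∀ m : ℕ, (c - ε) * (m : ℝ) ^ (1 / (d : ℝ)) - K ≤ permMean d m ∧
      permMean d m ≤ (c + ε) * (m : ℝ) ^ (1 / (d : ℝ)) + K := by
  have hc := h.nonneg
  obtain ⟨m₀, hm₀⟩ := Filter.eventually_atTop.1
    ((Metric.tendsto_nhds.1 (tendsto_permMean h) ε hε).and (Filter.eventually_ge_atTop 1))
  refine ⟨(1 + c) * m₀, by positivity, fun m => ?_⟩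
  have hK : 0 ≤ (1 + c) * (m₀ : ℝ) := by positivity
  have hpow : 0 ≤ (m : ℝ) ^ (1 / (d : ℝ)) := by positivity
  rcases le_or_gt m₀ m with hm | hm
  · obtain ⟨h1, h2⟩ := hm₀ m hm
    have hpos : 0 < (m : ℝ) ^ (1 / (d : ℝ)) := Real.rpow_pos_of_pos (by exact_mod_cast h2) _
    rw [Real.dist_eq, abs_lt] at h1
    have e : permMean d m = permMean d m / (m : ℝ) ^ (1 / (d : ℝ)) * (m : ℝ) ^ (1 / (d : ℝ)) := by
      field_simp
    constructor
    · have := mul_le_mul_of_nonneg_right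
        (by linarith : c - ε ≤ permMean d m / (m : ℝ) ^ (1 / (d : ℝ))) hpow
      linarith
    · have := mul_le_mul_of_nonneg_right
        (by linarith : permMean d m / (m : ℝ) ^ (1 / (d : ℝ)) ≤ c + ε) hpow
      linarith
  · have hmm : (m : ℝ) ≤ m₀ := by exact_mod_cast hm.le
    have h1 : (m : ℝ) ^ (1 / (d : ℝ)) ≤ m := by
      have hd' : (1 : ℝ) ≤ d := by exact_mod_cast hd
      rcases Nat.eq_zero_or_pos m with rfl | hmpos
      · rw [Nat.cast_zero, Real.zero_rpow (by positivity)]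
      · have h1m : (1 : ℝ) ≤ m := by exact_mod_cast hmpos
        calc (m : ℝ) ^ (1 / (d : ℝ)) ≤ (m : ℝ) ^ (1 : ℝ) :=
              Real.rpow_le_rpow_of_exponent_le h1m (by rw [div_le_one (by positivity)]; exact hd')
          _ = m := Real.rpow_one _
    have h2 := permMean_le d m
    have h3 := permMean_nonneg d m
    constructor
    · nlinarith [mul_nonneg hε.le hpow]
    · nlinarith [mul_nonneg (add_nonneg hc hε.le) hpow]

lemma rpow_le_tangent {a l x : ℝ} (ha : 0 ≤ a) (ha' : a ≤ 1) (hl : 0 < l) (hx : 0 ≤ x) :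
    x ^ a ≤ l ^ a * (1 + a * (x / l - 1)) := by
  have h := rpow_one_add_le_one_add_mul_self (s := x / l - 1)
    (by have := div_nonneg hx hl.le; linarith) ha ha'
  rw [add_sub_cancel, Real.div_rpow hx hl.le, div_le_iff₀ (Real.rpow_pos_of_pos hl a)] at h
  linarith

lemma le_rpow_quadratic {a l η x y : ℝ} (ha : 0 ≤ a) (ha' : a ≤ 1) (hl : 0 < l) (hη : 0 < η)
    (hx : 0 ≤ x) (hxy : x ≤ y) :
    l ^ a * (x / l - η - (y / l - 1) ^ 2 / (4 * η)) ≤ x ^ a := by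
  have hl' : 0 < l ^ a := Real.rpow_pos_of_pos hl a
  have e : x ^ a = l ^ a * (x / l) ^ a := by
    rw [Real.div_rpow hx hl.le]; field_simp
  rw [e]
  refine mul_le_mul_of_nonneg_left ?_ hl'.le
  have hxl : 0 ≤ x / l := div_nonneg hx hl.le
  rcases le_total (x / l) 1 with h | h
  · have h1 : x / l ≤ (x / l) ^ a := Real.self_le_rpow_of_le_one hxl h ha'
    have : 0 ≤ (y / l - 1) ^ 2 / (4 * η) := by positivity
    linarith
  · have h1 : 1 ≤ (x / l) ^ a := Real.one_le_rpow h ha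
    have h2 : x / l ≤ y / l := by gcongr
    have h3 : y / l - 1 ≤ η + (y / l - 1) ^ 2 / (4 * η) := by
      rw [← sub_nonneg]
      have : η + (y / l - 1) ^ 2 / (4 * η) - (y / l - 1) =
          ((y / l - 1) - 2 * η) ^ 2 / (4 * η) := by field_simp; ring
      rw [this]; positivity
    linarith

variable {n : Fin d → ℕ} {p : ℝ}

lemma intensity_pos (hn : ∀ i, 0 < n i) (hp0 : 0 < p) (hp : p < 1) :
    0 < -(Fintype.card (Edge n) * Real.log (1 - p)) := by
  have : Nonempty (Edge n) := ⟨fun i => ⟨0, hn i⟩⟩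
  have hc : (0 : ℝ) < Fintype.card (Edge n) := by exact_mod_cast Fintype.card_pos
  have := Real.log_neg (by linarith : 0 < 1 - p) (by linarith)
  rw [← mul_neg]
  exact mul_pos hc (by linarith)

lemma wExp_L_le_of_permMean_le (hd : 0 < d) (hn : ∀ i, 0 < n i) (hp0 : 0 < p) (hp : p < 1)
    {b K : ℝ} (hb : 0 ≤ b)
    (h : ∀ m : ℕ, permMean d m ≤ b * (m : ℝ) ^ (1 / (d : ℝ)) + K) :
    wExp (binomW p : HG n → ℝ) (fun H => (L H : ℝ)) ≤
      b * (-(Fintype.card (Edge n) * Real.log (1 - p))) ^ (1 / (d : ℝ)) + K := by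
  have hl0 := intensity_pos hn hp0 hp
  have hw := fun α β => wExp_L_le (α := α) (β := β) hn hp0.le hp
  set l := -(Fintype.card (Edge n) * Real.log (1 - p)) with hl
  set a : ℝ := 1 / (d : ℝ) with ha
  have hd' : (1 : ℝ) ≤ d := by exact_mod_cast hd
  have ha0 : 0 ≤ a := by positivity
  have ha1 : a ≤ 1 := by rw [ha, div_le_one (by positivity)]; exact hd'
  have := hw (b * l ^ a * (1 - a) + K) (b * l ^ a * a / l) fun m => by
    refine (h m).trans ?_
    have := mul_le_mul_of_nonneg_left
      (rpow_le_tangent ha0 ha1 hl0 (Nat.cast_nonneg (α := ℝ) m)) hb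
    refine (add_le_add_left this K).trans_eq ?_
    field_simp
    ring
  refine this.trans_eq ?_
  field_simp
  ring

lemma le_wExp_L_of_le_permMean (hd : 0 < d) (hn : ∀ i, 0 < n i) (hp0 : 0 < p) (hp : p < 1)
    {b K η : ℝ} (hb : 0 ≤ b) (hη : 0 < η)
    (h : ∀ m : ℕ, b * (m : ℝ) ^ (1 / (d : ℝ)) - K ≤ permMean d m) {l : ℝ}
    (hl : l = -(Fintype.card (Edge n) * Real.log (1 - p))) :
    b * l ^ (1 / (d : ℝ)) * (1 - η - 1 / (4 * η * l) - l * ∑ i, (1 / n i : ℝ)) - K ≤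
      wExp (binomW p : HG n → ℝ) (fun H => (L H : ℝ)) := by
  have hl0 := intensity_pos hn hp0 hp
  have hw := fun α β γ D => le_wExp_L (α := α) (β := β) (γ := γ) (D := D) hd hn hp0.le hp
  rw [← hl] at hl0 hw
  set a : ℝ := 1 / (d : ℝ) with ha
  have hd' : (1 : ℝ) ≤ d := by exact_mod_cast hd
  have ha0 : 0 ≤ a := by positivity
  have ha1 : a ≤ 1 := by rw [ha, div_le_one (by positivity)]; exact hd'
  have := hw (b * l ^ a * (-η - 1 / (4 * η)) - K)
    (b * l ^ a * (1 / l - 1 / (4 * η * l ^ 2) + 1 / (2 * η * l)))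
    (-(b * l ^ a / (4 * η * l ^ 2))) (b * l ^ a / l) (by positivity) fun m k hk => by
      refine le_trans ?_ (h k)
      have := mul_le_mul_of_nonneg_left (le_rpow_quadratic ha0 ha1 hl0 hη
        (Nat.cast_nonneg (α := ℝ) k) (by exact_mod_cast hk : (k : ℝ) ≤ m)) hb
      refine le_trans (le_of_eq ?_) (sub_le_sub_right this K)
      field_simp
      ring
  refine le_trans (le_of_eq ?_) this
  field_simp
  ring

end Asymptotics

section Parameters

lemma prod_mul_sum_inv_le {ι : Type*} (s : Finset ι) (x : ι → ℝ) (hx : ∀ i ∈ s, 0 < x i) :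
    (∏ i ∈ s, x i) * ∑ i ∈ s, 1 / x i ≤ (∑ i ∈ s, x i) ^ (s.card - 1) := by
  induction s using Finset.induction_on with
  | empty => simp
  | insert a s ha ih =>
    have hxs : ∀ i ∈ s, 0 < x i := fun i hi => hx i (Finset.mem_insert_of_mem hi)
    have hxa := hx a (Finset.mem_insert_self a s)
    have ih := ih hxs
    have hS : 0 ≤ ∑ i ∈ s, x i := Finset.sum_nonneg fun i hi => (hxs i hi).le
    rw [Finset.prod_insert ha, Finset.sum_insert ha, Finset.sum_insert ha,
      Finset.card_insert_of_notMem ha, Nat.add_sub_cancel]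
    have hP : ∏ i ∈ s, x i ≤ (∑ i ∈ s, x i) ^ s.card :=
      (Finset.prod_le_prod (fun i hi => (hxs i hi).le) fun i hi =>
        Finset.single_le_sum (f := x) (fun j hj => (hxs j hj).le) hi).trans_eq
          (Finset.prod_const _)
    have e : (x a * ∏ i ∈ s, x i) * (1 / x a + ∑ i ∈ s, 1 / x i) =
        ∏ i ∈ s, x i + x a * ((∏ i ∈ s, x i) * ∑ i ∈ s, 1 / x i) := by
      have h1 : x a * (1 / x a) = 1 := mul_one_div_cancel hxa.ne'
      linear_combination (∏ i ∈ s, x i) * h1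
    rcases Nat.eq_zero_or_pos s.card with h0 | h0
    · rw [Finset.card_eq_zero] at h0
      subst h0
      simp [hxa.ne']
    · obtain ⟨k, hk⟩ := Nat.exists_eq_succ_of_ne_zero h0.ne'
      rw [hk] at hP ih ⊢
      simp only [Nat.succ_eq_add_one, Nat.add_sub_cancel] at hP ih ⊢
      have h1 : (∑ i ∈ s, x i) ^ k ≤ (x a + ∑ i ∈ s, x i) ^ k := by
        gcongr; linarith
      have h2 := mul_le_mul_of_nonneg_left ih hxa.le
      calc _ = ∏ i ∈ s, x i + x a * ((∏ i ∈ s, x i) * ∑ i ∈ s, 1 / x i) := e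
        _ ≤ (∑ i ∈ s, x i) ^ (k + 1) + x a * (∑ i ∈ s, x i) ^ k := add_le_add hP h2
        _ = (∑ i ∈ s, x i) ^ k * (x a + ∑ i ∈ s, x i) := by ring
        _ ≤ (x a + ∑ i ∈ s, x i) ^ k * (x a + ∑ i ∈ s, x i) := by gcongr
        _ = _ := by ring

lemma neg_log_one_sub_le {p : ℝ} (hp : p ≤ 1 / 2) :
    -Real.log (1 - p) ≤ (1 + 2 * p) * p := by
  have h := Real.one_sub_inv_le_log_of_pos (by linarith : 0 < 1 - p)
  have : (1 - p)⁻¹ - 1 ≤ (1 + 2 * p) * p := by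
    rw [inv_eq_one_div, div_sub_one (by linarith), div_le_iff₀ (by linarith)]
    nlinarith [sq_nonneg p]
  linarith

lemma le_neg_log_one_sub {p : ℝ} (hp : p < 1) : p ≤ -Real.log (1 - p) := by
  have := Real.log_le_sub_one_of_pos (by linarith : 0 < 1 - p)
  linarith

variable {d : ℕ} {n : Fin d → ℕ}

lemma card_edge : (Fintype.card (Edge n) : ℝ) = ∏ i, (n i : ℝ) := by
  simp [Fintype.card_pi]

lemma geoMean_mul_rpow {p : ℝ} (hp : 0 ≤ p) :
    geoMean n * p ^ (1 / (d : ℝ)) = (Fintype.card (Edge n) * p) ^ (1 / (d : ℝ)) := by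
  rw [geoMean, card_edge, Real.mul_rpow (Finset.prod_nonneg fun i _ => Nat.cast_nonneg _) hp]

lemma one_le_sumSizes (hd : 0 < d) (hn : ∀ i, 0 < n i) : 1 ≤ sumSizes n := by
  have h1 : (1 : ℝ) ≤ n ⟨0, hd⟩ := by exact_mod_cast hn _
  exact h1.trans (Finset.single_le_sum (f := fun i => (n i : ℝ)) (fun i _ => Nat.cast_nonneg _)
    (Finset.mem_univ _))

lemma geoMean_le_sumSizes (hd : 0 < d) (n : Fin d → ℕ) : geoMean n ≤ sumSizes n := by
  have hS : 0 ≤ sumSizes n := Finset.sum_nonneg fun i _ => Nat.cast_nonneg _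
  have h : ∏ i, (n i : ℝ) ≤ sumSizes n ^ d := by
    have := Finset.prod_le_prod (s := Finset.univ) (f := fun i => (n i : ℝ))
      (g := fun _ => sumSizes n) (fun i _ => Nat.cast_nonneg _) fun i hi =>
        Finset.single_le_sum (f := fun i => (n i : ℝ)) (fun i _ => Nat.cast_nonneg _) hi
    simpa using this
  calc geoMean n ≤ (sumSizes n ^ d) ^ (1 / (d : ℝ)) :=
        Real.rpow_le_rpow (Finset.prod_nonneg fun i _ => Nat.cast_nonneg _) h (by positivity)
    _ = sumSizes n := by rw [one_div, Real.pow_rpow_inv_natCast hS hd.ne']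

lemma IsMedianW.nonneg {p m : ℝ}
    (hm : IsMedianW (binomW p : HG n → ℝ) (fun H => (L H : ℝ)) m) : 0 ≤ m := by
  by_contra! h
  have h1 := hm.1
  have : (Finset.univ.filter (· ∈ {H : HG n | (L H : ℝ) ≤ m})) = ∅ := by
    refine Finset.filter_eq_empty_iff.2 fun H _ hH => ?_
    have hH : (L H : ℝ) ≤ m := hH
    have := Nat.cast_nonneg (α := ℝ) (L H)
    linarith
  rw [wProb, this, Finset.sum_empty] at h1
  norm_num at h1

end Parameters

lemma exists_median_le {d : ℕ} (hd : 2 ≤ d) {c : ℝ} (h : IsBWConstant d c) (hc : 0 < c) {δ : ℝ}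
    (hδ : 0 < δ) :
    ∃ C : ℝ, ∀ n : Fin d → ℕ, (∀ i, 0 < n i) → ∀ p : ℝ, 0 < p → p < 1 →
      C ≤ geoMean n * p ^ (1 / (d : ℝ)) →
      12 * sumSizes n ^ (2 * d - 2) * p ^ (2 - 1 / (d : ℝ)) ≤ (d : ℝ) ^ (d - 1) * δ * c →
      ∀ m : ℝ, IsMedianW (binomW p : HG n → ℝ) (fun H => (L H : ℝ)) m →
        m ≤ (1 + δ) * (c * geoMean n * p ^ (1 / (d : ℝ))) := by
  have hd0 : 0 < d := by omega
  set τ : ℝ := min (δ / 20) (1 / 2) with hτ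
  have hτ0 : 0 < τ := by positivity
  have hτ1 : τ ≤ δ / 20 := min_le_left _ _
  have hτ2 : τ ≤ 1 / 2 := min_le_right _ _
  obtain ⟨K, hK0, hK⟩ := exists_permMean_bounds hd0 h (mul_pos hc hτ0)
  set Q : ℝ := (d : ℝ) ^ (d - 1) * δ * c with hQ
  refine ⟨max (max 1 (4 * K / (c * δ))) (max (Q / (12 * τ ^ 2)) (8 * (1 + δ / 2) / (δ ^ 2 * c) + 1)),
    fun n hn p hp0 hp hC hS m hm => ?_⟩
  set X := geoMean n * p ^ (1 / (d : ℝ)) with hX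
  have hX1 : 1 ≤ X := (le_max_left _ _).trans ((le_max_left _ _).trans hC)
  have hX2 : 4 * K / (c * δ) ≤ X := (le_max_right _ _).trans ((le_max_left _ _).trans hC)
  have hX3 : Q / (12 * τ ^ 2) ≤ X := (le_max_left _ _).trans ((le_max_right _ _).trans hC)
  have hX4 : 8 * (1 + δ / 2) / (δ ^ 2 * c) + 1 ≤ X :=
    (le_max_right _ _).trans ((le_max_right _ _).trans hC)
  have ha0 : 0 ≤ 1 / (d : ℝ) := by positivity
  have hd1 : (1 : ℝ) ≤ d := by exact_mod_cast hd0
  have ha1 : 1 / (d : ℝ) ≤ 1 := by rw [div_le_one (by positivity)]; exact hd1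
  have hpτ : p ≤ τ := by
    by_contra! hlt
    have hS1 := one_le_sumSizes hd0 hn
    have hXS : X ≤ sumSizes n := by
      refine le_trans ?_ (geoMean_le_sumSizes hd0 n)
      have : 0 ≤ geoMean n :=
        Real.rpow_nonneg (Finset.prod_nonneg fun i _ => Nat.cast_nonneg _) _
      exact mul_le_of_le_one_right this (Real.rpow_le_one hp0.le hp.le ha0)
    have hSS : sumSizes n ≤ sumSizes n ^ (2 * d - 2) := le_self_pow₀ hS1 (by omega)
    have hpp : p ^ 2 ≤ p ^ (2 - 1 / (d : ℝ)) := by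
      rw [← Real.rpow_natCast p 2]
      exact Real.rpow_le_rpow_of_exponent_ge hp0 hp.le (by push_cast; linarith)
    have h1 : 12 * X * p ^ 2 ≤ Q := by
      refine le_trans ?_ hS
      have : X ≤ sumSizes n ^ (2 * d - 2) := hXS.trans hSS
      gcongr
    rw [div_le_iff₀ (by positivity)] at hX3
    have : τ ^ 2 < p ^ 2 := by gcongr
    nlinarith
  have hE := wExp_L_le_of_permMean_le hd0 hn hp0 hp (by positivity) fun m => (hK m).2
  have hl : (-(Fintype.card (Edge n) * Real.log (1 - p))) ^ (1 / (d : ℝ)) ≤ (1 + 2 * τ) * X := by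
    have h1 : -(Fintype.card (Edge n) * Real.log (1 - p)) ≤
        (1 + 2 * τ) * (Fintype.card (Edge n) * p) := by
      rw [← mul_neg]
      have h2 : -Real.log (1 - p) ≤ (1 + 2 * τ) * p :=
        (neg_log_one_sub_le (hpτ.trans hτ2)).trans (by gcongr)
      refine (mul_le_mul_of_nonneg_left h2 (Nat.cast_nonneg _)).trans_eq (by ring)
    refine (Real.rpow_le_rpow (intensity_pos hn hp0 hp).le h1 ha0).trans ?_
    rw [Real.mul_rpow (by positivity) (by positivity), ← geoMean_mul_rpow hp0.le]
    refine mul_le_mul_of_nonneg_right ?_ (by linarith)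
    exact (Real.rpow_le_rpow_of_exponent_le (by linarith) ha1).trans_eq (Real.rpow_one _)
  have hmed := sq_median_sub_mean_le hp0.le hp.le hm
  set E := wExp (binomW p : HG n → ℝ) (fun H => (L H : ℝ))
  have hE2 : E ≤ (1 + δ / 2) * (c * X) := by
    have h1 := mul_le_mul_of_nonneg_left hl (by positivity : 0 ≤ c + c * τ)
    have h2 : K ≤ δ / 4 * (c * X) := by
      rw [div_le_iff₀ (by positivity)] at hX2; linarith
    have h3 : (1 + τ) * (1 + 2 * τ) ≤ 1 + δ / 4 := by nlinarith
    have h4 := mul_le_mul_of_nonneg_right h3 (by positivity : 0 ≤ c * X)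
    linarith
  rw [mul_assoc c, ← hX]
  by_contra! hlt
  have h1 : δ / 2 * (c * X) ≤ m - E := by linarith
  have h2 : (δ / 2 * (c * X)) ^ 2 ≤ (m - E) ^ 2 := by gcongr
  have h3 : (c * X) * (δ ^ 2 * (c * X)) ≤ (c * X) * (8 * (1 + δ / 2)) := by linarith
  have h4 := le_of_mul_le_mul_left h3 (by positivity)
  have h5 : 8 * (1 + δ / 2) / (δ ^ 2 * c) < X := by linarith
  rw [div_lt_iff₀ (by positivity)] at h5
  linarith

lemma median_deviation_absurd {c δ X E m : ℝ} (hc : 0 < c) (hδ : 0 < δ) (hδ1 : δ < 1)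
    (hX : 16 / (δ ^ 2 * c) + 1 ≤ X) (hE : (1 - δ / 2) * (c * X) ≤ E)
    (hm : m < (1 - δ) * (c * X)) (hmed : (m - E) ^ 2 ≤ 2 * E) : False := by
  have h5 : 16 / (δ ^ 2 * c) < X := by linarith
  have hX0 : 0 < X := lt_of_le_of_lt (by positivity) h5
  have hcX : 0 < c * X := by positivity
  have hEpos : 0 < E := by nlinarith
  have h1 : δ / 2 * E ≤ E - m := by nlinarith
  have h2 : (δ / 2 * E) ^ 2 ≤ (E - m) ^ 2 := by gcongr
  have h3 : E * (δ ^ 2 * E) ≤ E * 8 := by linarith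
  have h4 := le_of_mul_le_mul_left h3 hEpos
  rw [div_lt_iff₀ (by positivity)] at h5
  have h6 : δ ^ 2 * (c * X / 2) ≤ δ ^ 2 * E := by
    gcongr
    nlinarith
  linarith

lemma exists_le_median {d : ℕ} (hd : 2 ≤ d) {c : ℝ} (h : IsBWConstant d c) (hc : 0 < c) {δ : ℝ}
    (hδ : 0 < δ) (hδ1 : δ < 1) :
    ∃ C : ℝ, ∀ n : Fin d → ℕ, (∀ i, 0 < n i) → ∀ p : ℝ, 0 < p → p < 1 →
      C ≤ geoMean n * p ^ (1 / (d : ℝ)) → 12 * sumSizes n ^ (d - 1) * p ≤ δ →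
      ∀ m : ℝ, IsMedianW (binomW p : HG n → ℝ) (fun H => (L H : ℝ)) m →
        (1 - δ) * (c * geoMean n * p ^ (1 / (d : ℝ))) ≤ m := by
  have hd0 : 0 < d := by omega
  obtain ⟨K, hK0, hK⟩ := exists_permMean_bounds hd0 h (by positivity : 0 < c * (δ / 12))
  refine ⟨max (max 1 (12 * K / (c * δ))) (max (36 / δ ^ 2) (16 / (δ ^ 2 * c) + 1)),
    fun n hn p hp0 hp hC hS m hm => ?_⟩
  have hb : 0 ≤ c - c * (δ / 12) := by nlinarith
  have hE := le_wExp_L_of_le_permMean hd0 hn hp0 hp hb (by positivity : 0 < δ / 12)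
    (fun m => (hK m).1) rfl
  have hl0 := intensity_pos hn hp0 hp
  set X := geoMean n * p ^ (1 / (d : ℝ)) with hX
  have hX1 : 1 ≤ X := (le_max_left _ _).trans ((le_max_left _ _).trans hC)
  have hX2 : 12 * K / (c * δ) ≤ X := (le_max_right _ _).trans ((le_max_left _ _).trans hC)
  have hX3 : 36 / δ ^ 2 ≤ X := (le_max_left _ _).trans ((le_max_right _ _).trans hC)
  have hX4 : 16 / (δ ^ 2 * c) + 1 ≤ X := (le_max_right _ _).trans ((le_max_right _ _).trans hC)
  have ha0 : 0 ≤ 1 / (d : ℝ) := by positivity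
  have hS1 := one_le_sumSizes hd0 hn
  have hp2 : p ≤ 1 / 2 := by
    have : 1 ≤ sumSizes n ^ (d - 1) := one_le_pow₀ hS1
    nlinarith
  have hlow : Fintype.card (Edge n) * p ≤ -(Fintype.card (Edge n) * Real.log (1 - p)) := by
    rw [← mul_neg]
    exact mul_le_mul_of_nonneg_left (le_neg_log_one_sub hp) (Nat.cast_nonneg _)
  have hup : -(Fintype.card (Edge n) * Real.log (1 - p)) ≤ 2 * (Fintype.card (Edge n) * p) := by
    rw [← mul_neg]
    have h2 : -Real.log (1 - p) ≤ 2 * p := (neg_log_one_sub_le hp2).trans (by nlinarith)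
    exact (mul_le_mul_of_nonneg_left h2 (Nat.cast_nonneg _)).trans_eq (by ring)
  set l := -(Fintype.card (Edge n) * Real.log (1 - p)) with hl
  have hXl : X ≤ l ^ (1 / (d : ℝ)) := by
    rw [hX, geoMean_mul_rpow hp0.le]
    exact Real.rpow_le_rpow (by positivity) hlow ha0
  have hXl' : X ≤ l := by
    refine le_trans ?_ hlow
    have hXd : X ^ d = Fintype.card (Edge n) * p := by
      rw [hX, geoMean_mul_rpow hp0.le, one_div, Real.rpow_inv_natCast_pow (by positivity) hd0.ne']
    rw [← hXd]
    exact le_self_pow₀ hX1 hd0.ne'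
  have hcoll : l * ∑ i, (1 / n i : ℝ) ≤ δ / 6 := by
    have h1 := prod_mul_sum_inv_le Finset.univ (fun i => (n i : ℝ))
      fun i _ => by exact_mod_cast hn i
    rw [Finset.card_univ, Fintype.card_fin, ← card_edge] at h1
    have h2 : 0 ≤ ∑ i, (1 / n i : ℝ) := Finset.sum_nonneg fun i _ => by positivity
    have h3 := mul_le_mul_of_nonneg_right hup h2
    have h4 := mul_le_mul_of_nonneg_right h1 hp0.le
    have hS' : 12 * (∑ i, (n i : ℝ)) ^ (d - 1) * p ≤ δ := hS
    linarith
  have hsmall : 1 / (4 * (δ / 12) * l) ≤ δ / 12 := by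
    rw [div_le_iff₀ (by positivity)]
    rw [div_le_iff₀ (by positivity)] at hX3
    have := mul_le_mul_of_nonneg_right hXl' (sq_nonneg δ)
    linarith
  have hmed := sq_median_sub_mean_le hp0.le hp.le hm
  set E := wExp (binomW p : HG n → ℝ) (fun H => (L H : ℝ))
  have hE2 : (1 - δ / 2) * (c * X) ≤ E := by
    have h1 : 1 - δ / 3 ≤ 1 - δ / 12 - 1 / (4 * (δ / 12) * l) - l * ∑ i, (1 / n i : ℝ) := by
      linarith
    have h2 := mul_le_mul (mul_le_mul_of_nonneg_left hXl hb) h1 (by linarith) (by positivity)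
    have h3 : K ≤ δ / 12 * (c * X) := by
      rw [div_le_iff₀ (by positivity)] at hX2; linarith
    have h4 : 1 - 5 * δ / 12 ≤ (1 - δ / 12) * (1 - δ / 3) := by nlinarith
    have h5 := mul_le_mul_of_nonneg_right h4 (by positivity : 0 ≤ c * X)
    linarith
  rw [mul_assoc c, ← hX]
  by_contra! hlt
  exact median_deviation_absurd hc hδ hδ1 hX4 hE2 hlt (by linarith)

/-- Median estimates for the binomial random hyper-graph model in terms of the
Bollobás–Winkler constant `c_d`. -/
theorem binomial_median_estimate (d : ℕ) (hd : 2 ≤ d) (cd : ℝ) (hcd : IsBWConstant d cd)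
    (δ : ℝ) (hδ : 0 < δ) :
    ∃ C : ℝ, ∀ (n : Fin d → ℕ), (∀ i, 0 < n i) → ∀ p : ℝ, 0 < p → p < 1 →
      let N : ℝ := geoMean n
      let S : ℝ := sumSizes n
      let M : ℝ := cd * N * p ^ (1 / (d : ℝ))
      (C ≤ N * p ^ (1 / (d : ℝ)) →
        12 * S ^ (2 * d - 2) * p ^ (2 - 1 / (d : ℝ)) ≤ (d : ℝ) ^ (d - 1) * δ * cd →
        ∀ m : ℝ, IsMedianW (binomW p : HG n → ℝ) (fun H => (L H : ℝ)) m →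
          m ≤ (1 + δ) * M) ∧
      (C ≤ N * p ^ (1 / (d : ℝ)) →
        12 * S ^ (d - 1) * p ≤ δ →
        ∀ m : ℝ, IsMedianW (binomW p : HG n → ℝ) (fun H => (L H : ℝ)) m →
          (1 - δ) * M ≤ m) := by
  have hgeo : ∀ n : Fin d → ℕ, 0 ≤ geoMean n := fun n =>
    Real.rpow_nonneg (Finset.prod_nonneg fun i _ => Nat.cast_nonneg _) _
  rcases hcd.nonneg.eq_or_lt with rfl | hc
  · refine ⟨0, fun n hn p hp0 hp => ⟨fun _ h => ?_, fun _ _ m hm => by simpa using hm.nonneg⟩⟩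
    have : 0 < sumSizes n := by linarith [one_le_sumSizes (by omega) hn]
    have : 0 < 12 * sumSizes n ^ (2 * d - 2) * p ^ (2 - 1 / (d : ℝ)) := by positivity
    simp only [mul_zero] at h
    exact absurd h (not_le.2 this)
  · obtain ⟨C₁, h₁⟩ := exists_median_le hd hcd hc hδ
    rcases le_or_gt 1 δ with hδ1 | hδ1
    · refine ⟨C₁, fun n hn p hp0 hp => ⟨h₁ n hn p hp0 hp, fun _ _ m hm => ?_⟩⟩
      refine le_trans (mul_nonpos_of_nonpos_of_nonneg (by linarith) ?_) hm.nonneg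
      have := hgeo n
      positivity
    · obtain ⟨C₂, h₂⟩ := exists_le_median hd hcd hc hδ hδ1
      exact ⟨max C₁ C₂, fun n hn p hp0 hp => ⟨fun hC => h₁ n hn p hp0 hp ((le_max_left _ _).trans hC),
        fun hC => h₂ n hn p hp0 hp ((le_max_right _ _).trans hC)⟩⟩
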